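/- For every positive integer k, the numerical semigroup generated by S = {6k+5, 12k+4, 12k+6} is a 3-permutation numerical semigroup. -/

import Mathlib

/-- The increasing enumeration of the positive elements of a submonoid `G` of `ℕ`
(0-indexed: `posSeq G 0` is the smallest positive element `g₁` of `G`). -/
noncomputable def posSeq (G : AddSubmonoid ℕ) : ℕ → ℕ :=
  Nat.nth (fun x => x ∈ G ∧ 0 < x)

/-- `G` is an `n`-permutation numerical semigroup: `G` is a cofinite submonoid of `ℕ`,
it is generated by its `n` smallest positive elements `g₁ < ⋯ < gₙ`, and for every
`k ≥ 0` the tuple `(g_{kn+1} mod n, …, g_{kn+n} mod n)` contains exactly one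
representative of each residue class of `ℤ/nℤ`. -/
def IsPermutationSemigroup (n : ℕ) (G : AddSubmonoid ℕ) : Prop :=
  ((G : Set ℕ)ᶜ).Finite ∧
  G = AddSubmonoid.closure (posSeq G '' Set.Iio n) ∧
  ∀ k : ℕ, Function.Bijective (fun j : Fin n => ((posSeq G (k * n + j.val) : ℕ) : ZMod n))

/-- Lower end of level `j`. -/
def lvS (k j : ℕ) : ℕ := 6 * (k * j) + 2 * j + 3 * (j % 2)

/-- Upper end of level `j`. -/
def lvT (k j : ℕ) : ℕ := 6 * (k * j) + 5 * j

/-- Level `j`: the sums of elements of weight `j`. -/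
def Lv (k j x : ℕ) : Prop :=
  x % 2 = j % 2 ∧ lvS k j ≤ x ∧ x ≤ lvT k j ∧ x + 2 ≠ lvT k j

/-- The semigroup. -/
abbrev GG (k : ℕ) : AddSubmonoid ℕ :=
  AddSubmonoid.closure ({6 * k + 5, 12 * k + 4, 12 * k + 6} : Set ℕ)

lemma gen_a (k : ℕ) : 6 * k + 5 ∈ GG k := AddSubmonoid.subset_closure (by simp)
lemma gen_b (k : ℕ) : 12 * k + 4 ∈ GG k := AddSubmonoid.subset_closure (by simp)
lemma gen_c (k : ℕ) : 12 * k + 6 ∈ GG k := AddSubmonoid.subset_closure (by simp)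

lemma Lv_add {k i j x y : ℕ} (hx : Lv k i x) (hy : Lv k j y) : Lv k (i + j) (x + y) := by
  unfold Lv lvS lvT at *
  rw [mul_add]
  generalize k * i = A at *
  generalize k * j = B at *
  omega

lemma exists_Lv {k x : ℕ} (hx : x ∈ GG k) : ∃ j, Lv k j x := by
  induction hx using AddSubmonoid.closure_induction with
  | mem x h =>
    simp only [Set.mem_insert_iff, Set.mem_singleton_iff] at h
    rcases h with h | h | h
    · exact ⟨1, by unfold Lv lvS lvT; omega⟩
    · exact ⟨2, by unfold Lv lvS lvT; omega⟩
    · exact ⟨2, by unfold Lv lvS lvT; omega⟩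
  | zero => exact ⟨0, by unfold Lv lvS lvT; omega⟩
  | add x y _ _ hx hy =>
    obtain ⟨i, hi⟩ := hx
    obtain ⟨j, hj⟩ := hy
    exact ⟨i + j, Lv_add hi hj⟩

lemma mem_sub {k x y : ℕ} (hy : y ∈ GG k) (hle : y ≤ x) (h : x - y ∈ GG k) : x ∈ GG k := by
  have := (GG k).add_mem h hy
  rwa [Nat.sub_add_cancel hle] at this

lemma lvS_two (k j : ℕ) : lvS k (j + 2) = lvS k j + 12 * k + 4 := by
  unfold lvS; rw [mul_add]; omega
lemma lvT_one (k j : ℕ) : lvT k (j + 1) = lvT k j + 6 * k + 5 := by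
  unfold lvT; rw [mul_add]; omega
lemma lvT_eq (k j : ℕ) : lvT k j = lvS k j + 6 * (j / 2) := by
  unfold lvT lvS; omega
lemma lvS_one (k j : ℕ) : lvS k (j + 1) + 6 * (j % 2) = lvS k j + 6 * k + 5 := by
  unfold lvS; rw [mul_add]; omega
lemma lvS_par (k j : ℕ) : lvS k j % 2 = j % 2 := by
  unfold lvS; omega

lemma mem_of_Lv (k : ℕ) : ∀ j x, Lv k j x → x ∈ GG k
  | 0, x, h => by
    have : x = 0 := by unfold Lv lvS lvT at h; omega
    rw [this]; exact (GG k).zero_mem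
  | 1, x, h => by
    have : x = 6 * k + 5 := by unfold Lv lvS lvT at h; omega
    rw [this]; exact gen_a k
  | j + 2, x, h => by
    have ih := mem_of_Lv k j
    have h1 := lvS_two k j
    have h2 := lvT_one k j
    have h3 := lvT_one k (j + 1)
    have h4 := lvT_eq k j
    have h5 := lvS_par k j
    have key : (12 * k + 4 ≤ x ∧ Lv k j (x - (12 * k + 4))) ∨
        (12 * k + 6 ≤ x ∧ Lv k j (x - (12 * k + 6))) ∨
        (12 * k + 10 ≤ x ∧ Lv k j (x - (12 * k + 10))) := by
      unfold Lv at h ⊢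
      rw [show j + 1 + 1 = j + 2 from rfl] at h3
      omega
    rcases key with ⟨hl, hm⟩ | ⟨hl, hm⟩ | ⟨hl, hm⟩
    · exact mem_sub (gen_b k) hl (ih _ hm)
    · exact mem_sub (gen_c k) hl (ih _ hm)
    · refine mem_sub ?_ hl (ih _ hm)
      have := (GG k).add_mem (gen_a k) (gen_a k)
      rwa [show 6 * k + 5 + (6 * k + 5) = 12 * k + 10 by ring] at this

lemma lvT_mono (k : ℕ) : Monotone (lvT k) :=
  monotone_nat_of_le_succ fun j => by rw [lvT_one]; omega

lemma lvS_mono (k : ℕ) (hk : 0 < k) : Monotone (lvS k) :=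
  monotone_nat_of_le_succ fun j => by have := lvS_one k j; omega

/-- Window lemma: only two levels matter. -/
lemma window {k j x : ℕ} (hk : 0 < k) (hx : x ∈ GG k) (h1 : lvT k j < x)
    (h2 : x < lvS k (j + 3)) : Lv k (j + 1) x ∨ Lv k (j + 2) x := by
  obtain ⟨i, hi⟩ := exists_Lv hx
  have hi1 : j < i := by
    by_contra hc
    have := lvT_mono k (not_lt.mp hc)
    have := hi.2.2.1
    omega
  have hi2 : i < j + 3 := by
    by_contra hc
    have := lvS_mono k hk (not_lt.mp hc)
    have := hi.2.1
    omega
  obtain rfl | rfl : i = j + 1 ∨ i = j + 2 := by omega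
  · exact Or.inl hi
  · exact Or.inr hi

lemma even_mem (k : ℕ) : ∀ n x, x ≤ n → x % 2 = 0 → lvS k (4 * k + 2) ≤ x → x ∈ GG k := by
  intro n
  induction n with
  | zero =>
    intro x hx h0 hs
    have : x = 0 := by omega
    rw [this]; exact (GG k).zero_mem
  | succ n ih =>
    intro x hx h0 hs
    by_cases hb : x < lvS k (4 * k + 2) + (12 * k + 4)
    · apply mem_of_Lv k (4 * k + 2)
      have := lvT_eq k (4 * k + 2)
      have := lvS_par k (4 * k + 2)
      unfold Lv
      omega
    · exact mem_sub (gen_b k) (by omega) (ih _ (by omega) (by omega) (by omega))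

lemma big_mem (k : ℕ) (x : ℕ) (h : lvS k (4 * k + 3) ≤ x) : x ∈ GG k := by
  have h1 := lvS_one k (4 * k + 2)
  rw [show 4 * k + 2 + 1 = 4 * k + 3 from rfl] at h1
  by_cases hp : x % 2 = 0
  · exact even_mem k x x le_rfl hp (by omega)
  · exact mem_sub (gen_a k) (by omega) (even_mem k x _ (by omega) (by omega) (by omega))

/-- Positive elements. -/
def PP (k x : ℕ) : Prop := x ∈ GG k ∧ 0 < x

/-- `a < b < c` are the next three positive elements from `x` on, with distinct residues. -/
def Trip (k x a b c : ℕ) : Prop :=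
  x ≤ a ∧ a < b ∧ b < c ∧ a ∈ GG k ∧ b ∈ GG k ∧ c ∈ GG k ∧
  (∀ y, x ≤ y → y ≤ c → y ∈ GG k → y = a ∨ y = b ∨ y = c) ∧
  a % 3 ≠ b % 3 ∧ a % 3 ≠ c % 3 ∧ b % 3 ≠ c % 3

/-- The invariant: positions where a new triple starts. The level is `j + 1`. -/
def TripInv (k x : ℕ) : Prop :=
  (∃ j, j ≤ 4 * k + 1 ∧ lvT k j < x ∧ x + 2 ≤ lvT k (j + 1) ∧
    (lvT k (j + 1) - x) % 6 = 2 ∧ x < lvS k (j + 2) ∧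
    (lvS k (j + 1) ≤ x ∨ x + 2 = lvT k (j + 1))) ∨
  (∃ j, j ≤ 4 * k ∧ lvT k j < x ∧ x + 2 ≤ lvT k (j + 1) ∧
    (lvT k (j + 1) - x) % 3 = 2 ∧ lvS k (j + 2) ≤ x) ∨
  lvS k (4 * k + 3) ≤ x

lemma inv_step {k x : ℕ} (hk : 0 < k) (h : TripInv k x) :
    ∃ a b c x', Trip k x a b c ∧ c < x' ∧ (∀ y, c < y → y < x' → y ∉ GG k) ∧ TripInv k x' := by
  rcases h with ⟨j, hj, h1, h2, h3, h4, h5⟩ | ⟨j, hj, h1, h2, h3, h4⟩ | h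
  · have e1 := lvT_one k j
    have e2 := lvT_one k (j + 1)
    have e3 := lvS_one k (j + 1)
    have e4 := lvS_one k (j + 2)
    have e5 := lvT_eq k (j + 1)
    have e6 := lvT_eq k (j + 2)
    have e7 := lvS_par k (j + 1)
    have e8 := lvS_par k (j + 2)
    simp only [add_assoc, Nat.reduceAdd] at e1 e2 e3 e4 e5 e6 e7 e8
    have w := fun y hy => window (k := k) (j := j) (x := y) hk hy
    have m1 := mem_of_Lv k (j + 1)
    have m2 := mem_of_Lv k (j + 2)
    unfold Lv at w m1 m2
    have e9 : lvS k (j + 2) % 6 = (x + 1) % 6 := by omega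
    by_cases hx : x + 2 = lvT k (j + 1)
    · have hj' : j ≤ 4 * k := by
        rcases Nat.lt_or_ge (4 * k) j with hc | hc
        · exfalso; omega
        · exact hc
      have hinv : TripInv k (lvS k (j + 2) + 4) := by
        refine Or.inl ⟨j + 1, ?_⟩
        simp only [add_assoc, Nat.reduceAdd]
        omega
      rcases Nat.lt_or_ge (x + 2) (lvS k (j + 2)) with hc | hc
      · refine ⟨x + 2, lvS k (j + 2), lvS k (j + 2) + 2, lvS k (j + 2) + 4,
          ⟨by omega, by omega, by omega, m1 _ (by omega), m2 _ (by omega), m2 _ (by omega), ?_,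
            by omega, by omega, by omega⟩, by omega, ?_, hinv⟩
        · intro y hy1 hy2 hy
          have := w y hy (by omega) (by omega)
          omega
        · intro y hy1 hy2 hy
          have := w y hy (by omega) (by omega)
          omega
      · refine ⟨lvS k (j + 2), x + 2, lvS k (j + 2) + 2, lvS k (j + 2) + 4,
          ⟨by omega, by omega, by omega, m2 _ (by omega), m1 _ (by omega), m2 _ (by omega), ?_,
            by omega, by omega, by omega⟩, by omega, ?_, hinv⟩
        · intro y hy1 hy2 hy
          have := w y hy (by omega) (by omega)
          omega
        · intro y hy1 hy2 hy
          have := w y hy (by omega) (by omega)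
          omega
    · rcases Nat.lt_or_ge (x + 1) (lvS k (j + 2)) with hc | hc
      · refine ⟨x, x + 2, x + 4, x + 6,
          ⟨by omega, by omega, by omega, m1 _ (by omega), m1 _ (by omega), m1 _ (by omega), ?_,
            by omega, by omega, by omega⟩, by omega, ?_, Or.inl ⟨j, by omega⟩⟩
        · intro y hy1 hy2 hy
          have := w y hy (by omega) (by omega)
          omega
        · intro y hy1 hy2 hy
          have := w y hy (by omega) (by omega)
          omega
      · refine ⟨x, x + 1, x + 2, x + 3,
          ⟨by omega, by omega, by omega, m1 _ (by omega), m2 _ (by omega), m1 _ (by omega), ?_,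
            by omega, by omega, by omega⟩, by omega, ?_, ?_⟩
        · intro y hy1 hy2 hy
          omega
        · intro y hy1 hy2 hy
          omega
        · right
          by_cases hj' : j = 4 * k + 1
          · right
            subst hj'
            rw [show 4 * k + 1 + 2 = 4 * k + 3 from rfl] at *
            omega
          · left
            exact ⟨j, by omega⟩
  · have e1 := lvT_one k j
    have e2 := lvT_one k (j + 1)
    have e3 := lvS_one k (j + 1)
    have e4 := lvS_one k (j + 2)
    have e5 := lvT_eq k (j + 1)
    have e6 := lvT_eq k (j + 2)
    have e7 := lvS_par k (j + 1)
    have e8 := lvS_par k (j + 2)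
    simp only [add_assoc, Nat.reduceAdd] at e1 e2 e3 e4 e5 e6 e7 e8
    have w := fun y hy => window (k := k) (j := j) (x := y) hk hy
    have m1 := mem_of_Lv k (j + 1)
    have m2 := mem_of_Lv k (j + 2)
    unfold Lv at w m1 m2
    by_cases hx : x + 2 = lvT k (j + 1)
    · refine ⟨x + 1, x + 2, x + 3, x + 5,
          ⟨by omega, by omega, by omega, m2 _ (by omega), m1 _ (by omega), m2 _ (by omega), ?_,
            by omega, by omega, by omega⟩, by omega, ?_, Or.inl ⟨j + 1, ?_⟩⟩
      · intro y hy1 hy2 hy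
        have := w y hy (by omega) (by omega)
        omega
      · intro y hy1 hy2 hy
        have := w y hy (by omega) (by omega)
        omega
      · simp only [add_assoc, Nat.reduceAdd]
        omega
    · have mm : ∀ y, x ≤ y → y ≤ x + 2 → y ∈ GG k := by
        intro y hy1 hy2
        by_cases hp : y % 2 = (j + 1) % 2
        · exact m1 _ (by omega)
        · exact m2 _ (by omega)
      refine ⟨x, x + 1, x + 2, x + 3,
          ⟨by omega, by omega, by omega, mm _ (by omega) (by omega), mm _ (by omega) (by omega),
            mm _ (by omega) (by omega), ?_,
            by omega, by omega, by omega⟩, by omega, ?_, Or.inr (Or.inl ⟨j, by omega⟩)⟩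
      · intro y hy1 hy2 hy
        omega
      · intro y hy1 hy2 hy
        omega
  · refine ⟨x, x + 1, x + 2, x + 3, ⟨by omega, by omega, by omega, big_mem k _ (by omega),
      big_mem k _ (by omega), big_mem k _ (by omega), ?_, by omega, by omega, by omega⟩,
      by omega, ?_, Or.inr (Or.inr (by omega))⟩
    · intro y hy1 hy2 hy
      omega
    · intro y hy1 hy2 hy
      omega

open Classical in
lemma trip_nth {k x a b c N : ℕ} (hx : 0 < x) (hN : Nat.count (PP k) x = N) (h : Trip k x a b c) :
    posSeq (GG k) N = a ∧ posSeq (GG k) (N + 1) = b ∧ posSeq (GG k) (N + 2) = c ∧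
      Nat.count (PP k) (c + 1) = N + 3 := by
  obtain ⟨h1, h2, h3, ha, hb, hc, hn, -⟩ := h
  have gap : ∀ u v, u ≤ v → (∀ y, u ≤ y → y < v → ¬ PP k y) →
      Nat.count (PP k) v = Nat.count (PP k) u := by
    intro u v huv
    induction v, huv using Nat.le_induction with
    | base => intro _; rfl
    | succ v hv ih =>
      intro hy
      rw [Nat.count_succ, if_neg (hy v hv (by omega)), add_zero]
      exact ih fun y h1 h2 => hy y h1 (by omega)
  have pa : PP k a := ⟨ha, by omega⟩
  have pb : PP k b := ⟨hb, by omega⟩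
  have pc : PP k c := ⟨hc, by omega⟩
  have ca : Nat.count (PP k) a = N := by
    rw [← hN]
    exact gap _ _ h1 fun y hy1 hy2 hp => by have := hn y hy1 (by omega) hp.1; omega
  have cb : Nat.count (PP k) b = N + 1 := by
    rw [gap (a + 1) b h2 fun y hy1 hy2 hp => by have := hn y (by omega) (by omega) hp.1; omega,
      Nat.count_succ, if_pos pa, ca]
  have cc : Nat.count (PP k) c = N + 2 := by
    rw [gap (b + 1) c h3 fun y hy1 hy2 hp => by have := hn y (by omega) (by omega) hp.1; omega,
      Nat.count_succ, if_pos pb, cb]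
  refine ⟨?_, ?_, ?_, ?_⟩
  · rw [← ca]; exact Nat.nth_count (p := PP k) pa
  · rw [← cb]; exact Nat.nth_count (p := PP k) pb
  · rw [← cc]; exact Nat.nth_count (p := PP k) pc
  · rw [Nat.count_succ, if_pos pc, cc]

open Classical in
lemma count_init (k : ℕ) : Nat.count (PP k) (6 * k + 3) = 0 := by
  rw [Nat.count_iff_forall_not]
  rintro y hy ⟨hm, hp⟩
  obtain ⟨j, hj⟩ := exists_Lv hm
  unfold Lv lvS lvT at hj
  rcases j with _ | j
  · omega
  · rw [mul_add] at hj; omega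

theorem family14_is_three_permutation (k : ℕ) (hk : 0 < k) :
    IsPermutationSemigroup 3 (AddSubmonoid.closure ({6 * k + 5, 12 * k + 4, 12 * k + 6} : Set ℕ)) := by
  classical
  have main : ∀ n, ∃ x, 0 < x ∧ Nat.count (PP k) x = n * 3 ∧ TripInv k x := by
    intro n
    induction n with
    | zero =>
      refine ⟨6 * k + 3, by omega, by rw [count_init], Or.inl ⟨0, ?_⟩⟩
      unfold lvS lvT
      omega
    | succ n ih =>
      obtain ⟨x, hx, hc, hI⟩ := ih
      obtain ⟨a, b, c, x', hT, hcx, hno, hI'⟩ := inv_step hk hI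
      refine ⟨x', by omega, ?_, hI'⟩
      have h4 := (trip_nth hx hc hT).2.2.2
      rw [show (n + 1) * 3 = n * 3 + 3 by ring, ← h4]
      clear hI'
      have : ∀ v, c + 1 ≤ v → (v ≤ x') → Nat.count (PP k) v = Nat.count (PP k) (c + 1) := by
        intro v hv
        induction v, hv using Nat.le_induction with
        | base => intro _; rfl
        | succ v hv ih =>
          intro hy
          rw [Nat.count_succ, if_neg (fun hp => hno v (by omega) (by omega) hp.1), add_zero]
          exact ih (by omega)
      exact this x' hcx le_rfl
  refine ⟨?_, ?_, ?_⟩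
  · apply (Set.finite_Iio (lvS k (4 * k + 3))).subset
    intro x hx
    by_contra hc
    exact hx (big_mem k x (by simpa using hc))
  · have hT : Trip k (6 * k + 3) (6 * k + 5) (12 * k + 4) (12 * k + 6) := by
      refine ⟨by omega, by omega, by omega, gen_a k, gen_b k, gen_c k, ?_, by omega, by omega,
        by omega⟩
      intro y h1 h2 hy
      have := window (j := 0) hk hy (by unfold lvT; omega) (by unfold lvS; omega)
      unfold Lv lvS lvT at this
      omega
    obtain ⟨h0, h1, h2, -⟩ := trip_nth (by omega) (count_init k) hT
    have : posSeq (GG k) '' Set.Iio 3 = {6 * k + 5, 12 * k + 4, 12 * k + 6} := by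
      rw [show Set.Iio 3 = ({0, 1, 2} : Set ℕ) by ext i; simp; omega]
      simp only [Set.image_insert_eq, Set.image_singleton]
      rw [h0, h1, h2]
    change _ = AddSubmonoid.closure (posSeq (GG k) '' Set.Iio 3)
    rw [this]
  · intro n
    obtain ⟨x, hx, hc, hI⟩ := main n
    obtain ⟨a, b, c, x', hT, -⟩ := inv_step hk hI
    obtain ⟨h0, h1, h2, -⟩ := trip_nth hx hc hT
    obtain ⟨-, -, -, -, -, -, -, d1, d2, d3⟩ := hT
    rw [Fintype.bijective_iff_injective_and_card]
    refine ⟨?_, by simp⟩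
    intro i j hij
    change ((posSeq (GG k) (n * 3 + i.val) : ℕ) : ZMod 3) = ((posSeq (GG k) (n * 3 + j.val) : ℕ) : ZMod 3) at hij
    rw [ZMod.natCast_eq_natCast_iff'] at hij
    fin_cases i <;> fin_cases j <;> simp [h0, h1, h2] at hij ⊢ <;> omega
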